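/- Let f be a Hurwitz-type matrix (HTM) polynomial of degree 2m with continued-fraction parameters c_0, ..., c_{m-1}, d_0, ..., d_{m-1} (Hermitian positive definite), and let s_0, ..., s_{2m-1} be Hermitian Markov parameters of f. Then the block Hankel matrices H_{1,k} and H_{2,k} (0 ≤ k ≤ m−1) are positive definite, and the continued-fraction parameters coincide with the Dyukarev–Stieltjes parameters: c_0 = s_0^{-1}, d_0 = s_0 s_1^{-1} s_0, and for 1 ≤ k ≤ m−1: c_k = e_k^* H_{1,k}^{-1} e_k − e_{k-1}^* H_{1,k-1}^{-1} e_{k-1} and d_k = y_k^* H_{2,k}^{-1} y_k − y_{k-1}^* H_{2,k-1}^{-1} y_{k-1}, where e_k ∈ ℂ^{(k+1)q×q} is the block column (I_q; 0_q; ...; 0_q) and y_k ∈ ℂ^{(k+1)q×q} is the block column (s_0; s_1; ...; s_k). -/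

import Mathlib

open Matrix MeasureTheory
open scoped ComplexOrder

noncomputable section

/-- The space of `q × q` complex matrices. -/
abbrev Mat (q : ℕ) := Matrix (Fin q) (Fin q) ℂ

/-- The h-part of an even-degree matrix polynomial
`f(z) = A 0 * z^(2m) + ... + A (2m)`:  `h(z) = A 0 * z^m + A 2 * z^(m-1) + ... + A (2m)`. -/
def hEven (q m : ℕ) (A : ℕ → Mat q) (z : ℂ) : Mat q :=
  ∑ j ∈ Finset.range (m + 1), z ^ (m - j) • A (2 * j)

/-- The g-part of an even-degree matrix polynomial:
`g(z) = A 1 * z^(m-1) + A 3 * z^(m-2) + ... + A (2m-1)`. -/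
def gEven (q m : ℕ) (A : ℕ → Mat q) (z : ℂ) : Mat q :=
  ∑ j ∈ Finset.range m, z ^ (m - 1 - j) • A (2 * j + 1)

/-- The h-part of an odd-degree matrix polynomial
`f(z) = A 0 * z^(2m+1) + ... + A (2m+1)`:  `h(z) = A 1 * z^m + ... + A (2m+1)`. -/
def hOdd (q m : ℕ) (A : ℕ → Mat q) (z : ℂ) : Mat q :=
  ∑ j ∈ Finset.range (m + 1), z ^ (m - j) • A (2 * j + 1)

/-- The g-part of an odd-degree matrix polynomial: `g(z) = A 0 * z^m + ... + A (2m)`. -/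
def gOdd (q m : ℕ) (A : ℕ → Mat q) (z : ℂ) : Mat q :=
  ∑ j ∈ Finset.range (m + 1), z ^ (m - j) • A (2 * j)

/-- The matrix polynomial `f(z) = A 0 * z^n + A 1 * z^(n-1) + ... + A n`. -/
def fPoly (q n : ℕ) (A : ℕ → Mat q) (z : ℂ) : Mat q :=
  ∑ j ∈ Finset.range (n + 1), z ^ (n - j) • A j

/-- Continued fraction for the even case:  `wEven q m c d j z = w_{m-1-j}(z)`, where
`w_{m-1}(z) = z c_{m-1} + d_{m-1}⁻¹` and `w_k(z) = z c_k + (d_k + w_{k+1}(z)⁻¹)⁻¹`. -/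
def wEven (q m : ℕ) (c d : ℕ → Mat q) : ℕ → ℂ → Mat q
  | 0, z => z • c (m - 1) + (d (m - 1))⁻¹
  | j + 1, z => z • c (m - 2 - j) + (d (m - 2 - j) + (wEven q m c d j z)⁻¹)⁻¹

/-- Continued fraction for the odd case:  `wOdd q m c d j z = w_{m-1-j}(z)`, where
`w_{m-1}(z) = z c_{m-1} + (d_{m-1} + z⁻¹ c_m⁻¹)⁻¹`. -/
def wOdd (q m : ℕ) (c d : ℕ → Mat q) : ℕ → ℂ → Mat q
  | 0, z => z • c (m - 1) + (d (m - 1) + z⁻¹ • (c m)⁻¹)⁻¹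
  | j + 1, z => z • c (m - 2 - j) + (d (m - 2 - j) + (wOdd q m c d j z)⁻¹)⁻¹

/-- A Hurwitz-type matrix polynomial of degree 2m, described through its h-part and g-part:
there are Hermitian positive definite matrices `c_0, ..., c_{m-1}`, `d_0, ..., d_{m-1}` with
`g(z) h(z)⁻¹ = w_0(z)⁻¹` whenever `det (h z) ≠ 0` and all inverses in the recursion exist. -/
def IsHTMEven (q m : ℕ) (h g : ℂ → Mat q) : Prop :=
  ∃ c d : ℕ → Mat q,
    (∀ k < m, (c k).PosDef) ∧ (∀ k < m, (d k).PosDef) ∧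
    ∀ z : ℂ, (h z).det ≠ 0 →
      (∀ j < m, IsUnit (wEven q m c d j z).det) →
      (∀ j, j + 1 < m → IsUnit (d (m - 2 - j) + (wEven q m c d j z)⁻¹).det) →
      g z * (h z)⁻¹ = (wEven q m c d (m - 1) z)⁻¹

/-- A Hurwitz-type matrix polynomial of degree 2m+1, described through its h-part and g-part:
there are Hermitian positive definite matrices `c_0, ..., c_m`, `d_0, ..., d_{m-1}` with
`h(z) (z g(z))⁻¹ = w_0(z)⁻¹` whenever `z ≠ 0`, `det (g z) ≠ 0` and all inverses exist. -/
def IsHTMOdd (q m : ℕ) (h g : ℂ → Mat q) : Prop :=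
  ∃ c d : ℕ → Mat q,
    (∀ k ≤ m, (c k).PosDef) ∧ (∀ k < m, (d k).PosDef) ∧
    ∀ z : ℂ, z ≠ 0 → (g z).det ≠ 0 →
      IsUnit (d (m - 1) + z⁻¹ • (c m)⁻¹).det →
      (∀ j < m, IsUnit (wOdd q m c d j z).det) →
      (∀ j, j + 1 < m → IsUnit (d (m - 2 - j) + (wOdd q m c d j z)⁻¹).det) →
      h z * (z • g z)⁻¹ = (wOdd q m c d (m - 1) z)⁻¹

/-- `s_0, ..., s_{2m-1}` are Markov parameters of the even-degree polynomial with
coefficients `A`:  `z^(2m) g(z) - (∑_{j<2m} (-1)^j s_j z^(2m-1-j)) h(z)` has degree ≤ m-1. -/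
def MarkovEven (q m : ℕ) (A s : ℕ → Mat q) : Prop :=
  ∃ B : ℕ → Mat q, ∀ z : ℂ,
    z ^ (2 * m) • gEven q m A z
      - (∑ j ∈ Finset.range (2 * m), ((-1 : ℂ) ^ j * z ^ (2 * m - 1 - j)) • s j) * hEven q m A z
    = ∑ k ∈ Finset.range m, z ^ k • B k

/-- `s_0, ..., s_{2m}` are Markov parameters of the odd-degree polynomial with coefficients
`A`:  `z^(2m+1) h(z) - (∑_{j≤2m} (-1)^j s_j z^(2m-j)) z g(z)` has degree ≤ m. -/
def MarkovOdd (q m : ℕ) (A s : ℕ → Mat q) : Prop :=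
  ∃ B : ℕ → Mat q, ∀ z : ℂ,
    z ^ (2 * m + 1) • hOdd q m A z
      - (∑ j ∈ Finset.range (2 * m + 1), ((-1 : ℂ) ^ j * z ^ (2 * m - j)) • s j) *
          (z • gOdd q m A z)
    = ∑ k ∈ Finset.range (m + 1), z ^ k • B k

/-- The block Hankel matrix `H_{1,n-1} = (s_{i+j})_{i,j=0}^{n-1}` with `n` block rows. -/
def H1b (q : ℕ) (s : ℕ → Mat q) (n : ℕ) : Matrix (Fin n × Fin q) (Fin n × Fin q) ℂ :=
  Matrix.of fun p r => s ((p.1 : ℕ) + (r.1 : ℕ)) p.2 r.2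

/-- The block Hankel matrix `H_{2,n-1} = (s_{i+j+1})_{i,j=0}^{n-1}` with `n` block rows. -/
def H2b (q : ℕ) (s : ℕ → Mat q) (n : ℕ) : Matrix (Fin n × Fin q) (Fin n × Fin q) ℂ :=
  Matrix.of fun p r => s ((p.1 : ℕ) + (r.1 : ℕ) + 1) p.2 r.2

/-- The block column `Y_{1,n} = (s_n; s_{n+1}; ...; s_{2n-1})`. -/
def Y1b (q : ℕ) (s : ℕ → Mat q) (n : ℕ) : Matrix (Fin n × Fin q) (Fin q) ℂ :=
  Matrix.of fun p b => s (n + (p.1 : ℕ)) p.2 b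

/-- The block column `Y_{2,n} = (s_{n+1}; ...; s_{2n})`. -/
def Y2b (q : ℕ) (s : ℕ → Mat q) (n : ℕ) : Matrix (Fin n × Fin q) (Fin q) ℂ :=
  Matrix.of fun p b => s (n + 1 + (p.1 : ℕ)) p.2 b

/-- The block column `col (I, z I, ..., z^(n-1) I)`. -/
def colPow (q n : ℕ) (z : ℂ) : Matrix (Fin n × Fin q) (Fin q) ℂ :=
  Matrix.of fun p b => z ^ (p.1 : ℕ) * (if p.2 = b then 1 else 0)

/-- `r_i(z) = ∑_{k=1}^{i} z^(i-k) s_{k-1}`. -/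
def rPol (q : ℕ) (s : ℕ → Mat q) (i : ℕ) (z : ℂ) : Mat q :=
  ∑ k ∈ Finset.range i, z ^ (i - 1 - k) • s k

/-- `t_i(z) = ∑_{k=0}^{i} z^(i-k) s_k`. -/
def tPol (q : ℕ) (s : ℕ → Mat q) (i : ℕ) (z : ℂ) : Mat q :=
  ∑ k ∈ Finset.range (i + 1), z ^ (i - k) • s k

/-- The block column `col (r_0(z), ..., r_{n-1}(z))`. -/
def colR (q : ℕ) (s : ℕ → Mat q) (n : ℕ) (z : ℂ) : Matrix (Fin n × Fin q) (Fin q) ℂ :=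
  Matrix.of fun p b => rPol q s (p.1 : ℕ) z p.2 b

/-- The block column `col (t_0(z), ..., t_{n-1}(z))`. -/
def colT (q : ℕ) (s : ℕ → Mat q) (n : ℕ) (z : ℂ) : Matrix (Fin n × Fin q) (Fin q) ℂ :=
  Matrix.of fun p b => tPol q s (p.1 : ℕ) z p.2 b

/-- `P_{1,j}(z) = z^j I - Y_{1,j}^* H_{1,j-1}⁻¹ col(I, zI, ..., z^(j-1) I)`. -/
def P1 (q : ℕ) (s : ℕ → Mat q) (j : ℕ) (z : ℂ) : Mat q :=
  z ^ j • (1 : Mat q) - (Y1b q s j)ᴴ * (H1b q s j)⁻¹ * colPow q j z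

/-- `P_{2,j}(z) = z^j I - Y_{2,j}^* H_{2,j-1}⁻¹ col(I, zI, ..., z^(j-1) I)`. -/
def P2 (q : ℕ) (s : ℕ → Mat q) (j : ℕ) (z : ℂ) : Mat q :=
  z ^ j • (1 : Mat q) - (Y2b q s j)ᴴ * (H2b q s j)⁻¹ * colPow q j z

/-- `Q_{1,j}(z) = r_j(z) - Y_{1,j}^* H_{1,j-1}⁻¹ col(r_0(z), ..., r_{j-1}(z))`. -/
def Q1 (q : ℕ) (s : ℕ → Mat q) (j : ℕ) (z : ℂ) : Mat q :=
  rPol q s j z - (Y1b q s j)ᴴ * (H1b q s j)⁻¹ * colR q s j z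

/-- `Q_{2,j}(z) = t_j(z) - Y_{2,j}^* H_{2,j-1}⁻¹ col(t_0(z), ..., t_{j-1}(z))`. -/
def Q2 (q : ℕ) (s : ℕ → Mat q) (j : ℕ) (z : ℂ) : Mat q :=
  tPol q s j z - (Y2b q s j)ᴴ * (H2b q s j)⁻¹ * colT q s j z

/-- The block column `e = (I; 0; ...; 0)` with `n` blocks. -/
def eCol (q n : ℕ) : Matrix (Fin n × Fin q) (Fin q) ℂ :=
  Matrix.of fun p b => if (p.1 : ℕ) = 0 then (if p.2 = b then 1 else 0) else 0

/-- The block column `y = (s_0; s_1; ...; s_{n-1})`. -/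
def yCol (q : ℕ) (s : ℕ → Mat q) (n : ℕ) : Matrix (Fin n × Fin q) (Fin q) ℂ :=
  Matrix.of fun p b => s (p.1 : ℕ) p.2 b

/-- Condition C: `A_i^* A_k = A_k^* A_i` for every odd `i` and even `k` with `i, k ≤ n`. -/
def CondC (q n : ℕ) (A : ℕ → Mat q) : Prop :=
  ∀ i k, i ≤ n → k ≤ n → i % 2 = 1 → k % 2 = 0 → (A i)ᴴ * A k = (A k)ᴴ * A i

/-- The symmetrizer: for a polynomial with (descending) coefficients `Q_0, ..., Q_{n-1}`
(read off as `Q_j = A (2j)`), the `n × n` block Hankel matrix whose `(i,k)` block is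
`A (2(n-1-i-k))` if `i + k ≤ n - 1`, and `0` otherwise. -/
def Sh (q n : ℕ) (A : ℕ → Mat q) : Matrix (Fin n × Fin q) (Fin n × Fin q) ℂ :=
  Matrix.of fun p r =>
    if (p.1 : ℕ) + (r.1 : ℕ) ≤ n - 1 then A (2 * (n - 1 - (p.1 : ℕ) - (r.1 : ℕ))) p.2 r.2
    else 0

/-- The signature matrix `J̃ = diag (I, -I, I, ..., ±I)` with `n` blocks. -/
def Jt (q n : ℕ) : Matrix (Fin n × Fin q) (Fin n × Fin q) ℂ :=
  Matrix.diagonal (fun p => (-1 : ℂ) ^ (p.1 : ℕ))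

/-- The block row `(I, x² I, ..., x^(2n-2) I)`. -/
def Rev (q n : ℕ) (x : ℂ) : Matrix (Fin q) (Fin n × Fin q) ℂ :=
  Matrix.of fun a p => x ^ (2 * (p.1 : ℕ)) * (if a = p.2 then 1 else 0)

/-- The block column `(I; y² I; ...; y^(2n-2) I)`. -/
def Cev (q n : ℕ) (y : ℂ) : Matrix (Fin n × Fin q) (Fin q) ℂ :=
  Matrix.of fun p b => y ^ (2 * (p.1 : ℕ)) * (if p.2 = b then 1 else 0)

/-- The block row `(x I, x³ I, ..., x^(2n-1) I)`. -/
def Rod (q n : ℕ) (x : ℂ) : Matrix (Fin q) (Fin n × Fin q) ℂ :=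
  Matrix.of fun a p => x ^ (2 * (p.1 : ℕ) + 1) * (if a = p.2 then 1 else 0)

/-- The block column `(y I; y³ I; ...; y^(2n-1) I)`. -/
def Cod (q n : ℕ) (y : ℂ) : Matrix (Fin n × Fin q) (Fin q) ℂ :=
  Matrix.of fun p b => y ^ (2 * (p.1 : ℕ) + 1) * (if p.2 = b then 1 else 0)

open Filter Topology

/-- A positive definite matrix has invertible determinant. -/
theorem Matrix.PosDef.det_isUnit {ι : Type*} [Fintype ι] [DecidableEq ι] {A : Matrix ι ι ℂ}
    (hA : A.PosDef) : IsUnit A.det :=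
  (Matrix.isUnit_iff_isUnit_det _).mp hA.isUnit

section BlockMatrices

variable {q : ℕ}

/-- The `n × n` block matrix with blocks `X i j`. -/
def blockMat (n : ℕ) (X : ℕ → ℕ → Mat q) : Matrix (Fin n × Fin q) (Fin n × Fin q) ℂ :=
  Matrix.of fun p r => X p.1 r.1 p.2 r.2

/-- The block column with `n` blocks `x i`. -/
def blockCol (n : ℕ) (x : ℕ → Mat q) : Matrix (Fin n × Fin q) (Fin q) ℂ :=
  Matrix.of fun p b => x p.1 p.2 b

theorem blockMat_mul (n : ℕ) (X Y : ℕ → ℕ → Mat q) :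
    blockMat n X * blockMat n Y =
      blockMat n fun i j => ∑ l ∈ Finset.range n, X i l * Y l j := by
  ext p r
  simp [blockMat, Matrix.mul_apply, Fintype.sum_prod_type, Matrix.sum_apply, Finset.sum_range]

theorem blockMat_mul_blockCol (n : ℕ) (X : ℕ → ℕ → Mat q) (y : ℕ → Mat q) :
    blockMat n X * blockCol n y =
      blockCol n fun i => ∑ l ∈ Finset.range n, X i l * y l := by
  ext p r
  simp [blockMat, blockCol, Matrix.mul_apply, Fintype.sum_prod_type, Matrix.sum_apply,
    Finset.sum_range]

theorem blockCol_conjTranspose_mul (n : ℕ) (x y : ℕ → Mat q) :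
    (blockCol n x)ᴴ * blockCol n y = ∑ l ∈ Finset.range n, (x l)ᴴ * y l := by
  ext p r
  simp [blockCol, Matrix.mul_apply, Fintype.sum_prod_type, Matrix.sum_apply, Finset.sum_range]

theorem blockMat_conjTranspose (n : ℕ) (X : ℕ → ℕ → Mat q) :
    (blockMat n X)ᴴ = blockMat n fun i j => (X j i)ᴴ := by
  ext p r
  simp [blockMat]

theorem blockMat_congr {n : ℕ} {X Y : ℕ → ℕ → Mat q} (h : ∀ i < n, ∀ j < n, X i j = Y i j) :
    blockMat n X = blockMat n Y := by
  ext p r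
  simp [blockMat, h p.1 p.1.2 r.1 r.1.2]

theorem blockCol_congr {n : ℕ} {x y : ℕ → Mat q} (h : ∀ i < n, x i = y i) :
    blockCol n x = blockCol n y := by
  ext p r
  simp [blockCol, h p.1 p.1.2]

/-- The block diagonal matrix with diagonal blocks `c i`. -/
def blockDiagMat (n : ℕ) (c : ℕ → Mat q) : Matrix (Fin n × Fin q) (Fin n × Fin q) ℂ :=
  blockMat n fun i j => if i = j then c i else 0

theorem blockDiagMat_mul_blockMat (n : ℕ) (c : ℕ → Mat q) (X : ℕ → ℕ → Mat q) :
    blockDiagMat n c * blockMat n X = blockMat n fun i j => c i * X i j := by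
  rw [blockDiagMat, blockMat_mul]
  refine blockMat_congr fun i hi j hj => ?_
  simp [ite_mul, hi]

theorem blockDiagMat_mul_blockCol (n : ℕ) (c : ℕ → Mat q) (x : ℕ → Mat q) :
    blockDiagMat n c * blockCol n x = blockCol n fun i => c i * x i := by
  rw [blockDiagMat, blockMat_mul_blockCol]
  refine blockCol_congr fun i hi => ?_
  simp [ite_mul, hi]

theorem blockDiagMat_inv {n : ℕ} {c : ℕ → Mat q} (hc : ∀ i < n, IsUnit (c i).det) :
    (blockDiagMat n c)⁻¹ = blockDiagMat n fun i => (c i)⁻¹ := by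
  refine Matrix.inv_eq_right_inv ?_
  rw [blockDiagMat, blockDiagMat, blockMat_mul]
  ext p r
  have := Matrix.mul_nonsing_inv _ (hc p.1 p.1.2)
  by_cases h : p.1 = r.1
  · simp [blockMat, h, Matrix.one_apply, Prod.ext_iff]
    simp [← h, this, Matrix.one_apply]
  · simp [blockMat, h, Prod.ext_iff, Fin.val_inj]

theorem blockDiagMat_posDef {n : ℕ} {c : ℕ → Mat q} (hc : ∀ i < n, (c i).PosDef) :
    (blockDiagMat n c).PosDef := by
  refine Matrix.PosDef.of_dotProduct_mulVec_pos ?_ fun x hx => ?_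
  · rw [Matrix.IsHermitian, blockDiagMat, blockMat_conjTranspose]
    refine blockMat_congr fun i hi j hj => ?_
    by_cases h : i = j
    · subst h; simpa using (hc i hi).isHermitian.eq
    · simp [h, Ne.symm h]
  · have key : star x ⬝ᵥ (blockDiagMat n c).mulVec x =
        ∑ i : Fin n, star (fun a => x (i, a)) ⬝ᵥ (c i).mulVec (fun a => x (i, a)) := by
      simp only [dotProduct, Matrix.mulVec, Fintype.sum_prod_type, blockDiagMat, blockMat,
        Matrix.of_apply, Fin.val_inj]
      refine Finset.sum_congr rfl fun i _ => Finset.sum_congr rfl fun a _ => ?_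
      rw [Finset.sum_eq_single i (fun j _ hj => by simp [hj.symm]) (by simp)]
      simp
    rw [key]
    obtain ⟨⟨i, a⟩, hia⟩ := Function.ne_iff.mp hx
    refine Finset.sum_pos' (fun j _ => (hc j j.2).posSemidef.dotProduct_mulVec_nonneg _)
      ⟨i, Finset.mem_univ _, (hc i i.2).dotProduct_mulVec_pos fun h => hia (congrFun h a)⟩

theorem blockMat_isUnit_det {n : ℕ} {X : ℕ → ℕ → Mat q}
    (hX : ∀ i < n, ∀ j < i, X i j = 0) (hd : ∀ i < n, IsUnit (X i i).det) :
    IsUnit (blockMat n X).det := by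
  have ht : (blockMat n X).BlockTriangular Prod.fst := by
    intro p r h
    simp [blockMat, hX p.1 p.1.2 r.1 h]
  rw [ht.det_fintype]
  refine IsUnit.prod_univ_iff.mpr fun k => ?_
  let e : {p : Fin n × Fin q // p.1 = k} ≃ Fin q :=
    { toFun := fun p => p.1.2
      invFun := fun a => ⟨(k, a), rfl⟩
      left_inv := by rintro ⟨⟨i, a⟩, rfl⟩; rfl
      right_inv := fun a => rfl }
  have : (blockMat n X).toSquareBlock Prod.fst k = (X k k).submatrix e e := by
    ext ⟨⟨i, a⟩, hi⟩ ⟨⟨j, b⟩, hj⟩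
    simp only at hi hj
    subst hi hj
    rfl
  rw [this, Matrix.det_submatrix_equiv_self]
  exact hd k k.2

/-- A congruence `H = Wᴴ P W` transports positive definiteness and, if `Wᴴ x = e`, the
quadratic form of the inverse. -/
theorem posDef_and_inv_form_of_congruence {ι κ : Type*} [Fintype ι] [DecidableEq ι]
    {H W P : Matrix ι ι ℂ} {x e : Matrix ι κ ℂ} (hW : IsUnit W.det) (hP : P.PosDef)
    (hH : H = Wᴴ * P * W) (hx : Wᴴ * x = e) :
    H.PosDef ∧ eᴴ * H⁻¹ * e = xᴴ * P⁻¹ * x := by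
  have hW' : IsUnit (Wᴴ).det := by simpa [Matrix.det_conjTranspose] using hW
  subst hH
  refine ⟨hP.conjTranspose_mul_mul_same
    (Matrix.mulVec_injective_iff_isUnit.mpr ((Matrix.isUnit_iff_isUnit_det _).mpr hW)), ?_⟩
  have h1 : Wᴴ⁻¹ * e = x := by rw [← hx, Matrix.nonsing_inv_mul_cancel_left _ _ hW']
  have h2 : eᴴ * W⁻¹ = xᴴ := by
    rw [← h1, Matrix.conjTranspose_mul, Matrix.conjTranspose_nonsing_inv,
      Matrix.conjTranspose_conjTranspose]
  calc eᴴ * (Wᴴ * P * W)⁻¹ * e = (eᴴ * W⁻¹) * P⁻¹ * (Wᴴ⁻¹ * e) := by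
        rw [Matrix.mul_inv_rev, Matrix.mul_inv_rev]; simp only [Matrix.mul_assoc]
    _ = _ := by rw [h1, h2]

/-- A block Gram matrix of a block triangular family is positive definite, and the quadratic form
of its inverse is computed blockwise. -/
theorem gram_posDef_and_inv_form {n : ℕ} {T X : ℕ → ℕ → Mat q} {p x e : ℕ → Mat q}
    (hX : ∀ i < n, ∀ j < i, X i j = 0) (hd : ∀ i < n, IsUnit (X i i).det)
    (hp : ∀ i < n, (p i).PosDef)
    (hT : ∀ i < n, ∀ j < n, T i j = ∑ l ∈ Finset.range n, (X l i)ᴴ * (p l * X l j))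
    (he : ∀ i < n, ∑ l ∈ Finset.range n, (X l i)ᴴ * x l = e i) :
    (blockMat n T).PosDef ∧
      (blockCol n e)ᴴ * (blockMat n T)⁻¹ * blockCol n e =
        ∑ l ∈ Finset.range n, (x l)ᴴ * ((p l)⁻¹ * x l) := by
  have h := posDef_and_inv_form_of_congruence (H := blockMat n T) (W := blockMat n X)
    (P := blockDiagMat n p) (x := blockCol n x) (e := blockCol n e)
    (blockMat_isUnit_det hX hd) (blockDiagMat_posDef hp)
    (by rw [Matrix.mul_assoc, blockDiagMat_mul_blockMat, blockMat_conjTranspose, blockMat_mul]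
        exact blockMat_congr hT)
    (by rw [blockMat_conjTranspose, blockMat_mul_blockCol]
        exact blockCol_congr he)
  refine ⟨h.1, h.2.trans ?_⟩
  rw [blockDiagMat_inv fun i hi => (hp i hi).det_isUnit,
    Matrix.mul_assoc, blockDiagMat_mul_blockCol, blockCol_conjTranspose_mul]

end BlockMatrices

section MomentVectors

variable {q : ℕ}

/-- The weighted differences `d_l⁻¹ (X_l - X_{l+1})`, shifted by one, with value `0` at `0`. -/
def flux (d X : ℕ → Mat q) : ℕ → Mat q
  | 0 => 0
  | l + 1 => (d l)⁻¹ * (X l - X (l + 1))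

/-- The block vectors `V_j = (C⁻¹ K)^j C⁻¹ E`, where `C` is block diagonal with blocks `c_l`
(`l < m`), `K` is the block tridiagonal matrix `X ↦ (flux d X (l+1) - flux d X l)_l`, and
`E = (I; 0; ...; 0)`. -/
def momentVec (m : ℕ) (c d : ℕ → Mat q) : ℕ → ℕ → Mat q
  | 0 => fun l => if l = 0 then (c 0)⁻¹ else 0
  | j + 1 => fun l =>
      if l < m then
        (c l)⁻¹ * (flux d (momentVec m c d j) (l + 1) - flux d (momentVec m c d j) l)
      else 0

/-- The sesquilinear form `∑ X_l^* c_l Y_l`. -/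
def massForm (m : ℕ) (c X Y : ℕ → Mat q) : Mat q :=
  ∑ l ∈ Finset.range m, (X l)ᴴ * (c l * Y l)

/-- The sesquilinear form `∑ (X_l - X_{l+1})^* d_l⁻¹ (Y_l - Y_{l+1})`. -/
def stiffForm (m : ℕ) (d X Y : ℕ → Mat q) : Mat q :=
  ∑ l ∈ Finset.range m, (X l - X (l + 1))ᴴ * ((d l)⁻¹ * (Y l - Y (l + 1)))

variable {m : ℕ} {c d : ℕ → Mat q}

theorem massForm_conjTranspose (hc : ∀ k < m, (c k).PosDef) (X Y : ℕ → Mat q) :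
    (massForm m c X Y)ᴴ = massForm m c Y X := by
  rw [massForm, massForm, Matrix.conjTranspose_sum]
  refine Finset.sum_congr rfl fun l hl => ?_
  simp [Matrix.mul_assoc, (hc l (Finset.mem_range.mp hl)).isHermitian.eq]

theorem stiffForm_conjTranspose (hd : ∀ k < m, (d k).PosDef) (X Y : ℕ → Mat q) :
    (stiffForm m d X Y)ᴴ = stiffForm m d Y X := by
  rw [stiffForm, stiffForm, Matrix.conjTranspose_sum]
  refine Finset.sum_congr rfl fun l hl => ?_
  simp [-Matrix.conjTranspose_sub, Matrix.mul_assoc,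
    (hd l (Finset.mem_range.mp hl)).inv.isHermitian.eq]

/-- Summation by parts. -/
theorem sum_conjTranspose_mul_flux_sub (X Y : ℕ → Mat q) (hX : X m = 0) :
    ∑ l ∈ Finset.range m, (X l)ᴴ * (flux d Y (l + 1) - flux d Y l) = stiffForm m d X Y := by
  have key : ∀ n, ∑ l ∈ Finset.range n, (X l)ᴴ * (flux d Y (l + 1) - flux d Y l) =
      stiffForm n d X Y + (X n)ᴴ * flux d Y n := by
    intro n
    induction n with
    | zero => simp [stiffForm, flux]
    | succ n ih =>
      rw [Finset.sum_range_succ, ih, stiffForm, stiffForm, Finset.sum_range_succ]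
      simp only [flux, Matrix.conjTranspose_sub]
      noncomm_ring
  simp [key, hX]

theorem momentVec_eq_zero_of_lt (j : ℕ) : ∀ l, j < l → momentVec m c d j l = 0 := by
  induction j with
  | zero => intro l hl; simp [momentVec, hl.ne']
  | succ j ih =>
    intro l hl
    obtain ⟨l, rfl⟩ : ∃ k, l = k + 1 := ⟨l - 1, by omega⟩
    simp [momentVec, flux, ih l (by omega), ih (l + 1) (by omega), ih (l + 1 + 1) (by omega)]

theorem momentVec_eq_zero_of_le (hm : 1 ≤ m) (j : ℕ) {l : ℕ} (hl : m ≤ l) :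
    momentVec m c d j l = 0 := by
  cases j with
  | zero => simp [momentVec, show l ≠ 0 by omega]
  | succ j => simp [momentVec, hl.not_gt]

theorem isUnit_det_momentVec_self (hc : ∀ k < m, (c k).PosDef) (hd : ∀ k < m, (d k).PosDef)
    (j : ℕ) (hj : j < m) : IsUnit (momentVec m c d j j).det := by
  induction j with
  | zero => simpa [momentVec] using (hc 0 hj).inv.det_isUnit
  | succ j ih =>
    simp only [momentVec, hj, if_true, flux, momentVec_eq_zero_of_lt j (j + 1) (by omega),
      momentVec_eq_zero_of_lt j (j + 1 + 1) (by omega), sub_zero, mul_zero, zero_sub, mul_neg,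
      Matrix.det_neg, Matrix.det_mul]
    exact ((isUnit_one.neg).pow _).mul
      ((hc _ hj).inv.det_isUnit.mul ((hd j (by omega)).inv.det_isUnit.mul (ih (by omega))))

theorem mass_mul_momentVec_succ (hc : ∀ k < m, (c k).PosDef) (j : ℕ) {l : ℕ} (hl : l < m) :
    c l * momentVec m c d (j + 1) l =
      flux d (momentVec m c d j) (l + 1) - flux d (momentVec m c d j) l := by
  simp only [momentVec, hl, if_true]
  exact Matrix.mul_nonsing_inv_cancel_left _ _ (hc l hl).det_isUnit

theorem massForm_momentVec_succ (hc : ∀ k < m, (c k).PosDef) {X : ℕ → Mat q} (hX : X m = 0)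
    (j : ℕ) :
    massForm m c X (momentVec m c d (j + 1)) = stiffForm m d X (momentVec m c d j) := by
  rw [← sum_conjTranspose_mul_flux_sub X _ hX, massForm]
  refine Finset.sum_congr rfl fun l hl => ?_
  rw [mass_mul_momentVec_succ hc j (Finset.mem_range.mp hl)]

theorem massForm_momentVec_zero_left (hm : 1 ≤ m) (hc : ∀ k < m, (c k).PosDef)
    (Y : ℕ → Mat q) : massForm m c (momentVec m c d 0) Y = Y 0 := by
  rw [massForm, Finset.sum_eq_single 0]
  · simp only [momentVec, if_true]
    rw [(hc 0 hm).inv.isHermitian.eq, Matrix.nonsing_inv_mul_cancel_left _ _ (hc 0 hm).det_isUnit]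
  · intro l _ hl; simp [momentVec, hl]
  · intro h; exact absurd (Finset.mem_range.mpr hm) h

theorem massForm_momentVec (hm : 1 ≤ m) (hc : ∀ k < m, (c k).PosDef)
    (hd : ∀ k < m, (d k).PosDef) (i j : ℕ) :
    massForm m c (momentVec m c d i) (momentVec m c d j) = momentVec m c d (i + j) 0 := by
  have hz : ∀ j, momentVec m c d j m = 0 := fun j => momentVec_eq_zero_of_le hm j le_rfl
  induction i generalizing j with
  | zero => rw [massForm_momentVec_zero_left hm hc, zero_add]
  | succ i ih =>
    rw [← massForm_conjTranspose hc, massForm_momentVec_succ hc (hz j),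
      stiffForm_conjTranspose hd, ← massForm_momentVec_succ hc (hz i), ih, add_right_comm,
      add_assoc]

theorem stiffForm_momentVec (hm : 1 ≤ m) (hc : ∀ k < m, (c k).PosDef)
    (hd : ∀ k < m, (d k).PosDef) (i j : ℕ) :
    stiffForm m d (momentVec m c d i) (momentVec m c d j) = momentVec m c d (i + j + 1) 0 := by
  rw [← massForm_momentVec_succ hc (momentVec_eq_zero_of_le hm i le_rfl),
    massForm_momentVec hm hc hd, add_assoc]

theorem sum_range_momentVec_eq {f : ℕ → Mat q} {i n : ℕ} (hi : i < n) (hn : n ≤ m)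
    (hf : ∀ l, i < l → f l = 0) :
    ∑ l ∈ Finset.range n, f l = ∑ l ∈ Finset.range m, f l := by
  refine Finset.sum_subset (Finset.range_subset_range.mpr hn) fun l _ hl => hf l ?_
  have := Finset.mem_range.not.mp hl
  omega

/-- The Hankel matrix `H_1` of the moments `(V_j)_0`. -/
theorem hankel_one_momentVec (hm : 1 ≤ m) (hc : ∀ k < m, (c k).PosDef)
    (hd : ∀ k < m, (d k).PosDef) {n : ℕ} (hn : n ≤ m) :
    (blockMat n fun i j => momentVec m c d (i + j) 0).PosDef ∧
      (eCol q n)ᴴ * (blockMat n fun i j => momentVec m c d (i + j) 0)⁻¹ * eCol q n =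
        ∑ l ∈ Finset.range n, c l := by
  have he : eCol q n = blockCol n fun i => if i = 0 then 1 else 0 := by
    ext p b
    by_cases h : (p.1 : ℕ) = 0 <;> simp [eCol, blockCol, h, Matrix.one_apply]
  have h := gram_posDef_and_inv_form (n := n) (T := fun i j => momentVec m c d (i + j) 0)
    (X := fun l j => momentVec m c d j l) (p := c) (x := c)
    (e := fun i => if i = 0 then 1 else 0)
    (fun i _ j hj => momentVec_eq_zero_of_lt j i hj)
    (fun i hi => isUnit_det_momentVec_self hc hd i (by omega))
    (fun i hi => hc i (by omega))
    (fun i hi j _ => by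
      rw [← massForm_momentVec hm hc hd, massForm]
      exact (sum_range_momentVec_eq hi hn fun l hl => by
        simp [momentVec_eq_zero_of_lt i l hl]).symm)
    (fun i hi => by
      rw [← Matrix.conjTranspose_inj, Matrix.conjTranspose_sum]
      cases i with
      | zero =>
        rw [Finset.sum_eq_single 0]
        · have hc0 := hc 0 hm
          simp [momentVec, hc0.isHermitian.eq, Matrix.mul_nonsing_inv _ hc0.det_isUnit]
        · intro l _ hl; simp [momentVec, hl]
        · intro h; exact absurd (Finset.mem_range.mpr hi) h
      | succ i =>
        have : ∀ l ∈ Finset.range n, ((momentVec m c d (i + 1) l)ᴴ * c l)ᴴ =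
            flux d (momentVec m c d i) (l + 1) - flux d (momentVec m c d i) l := by
          intro l hl
          have hl' : l < m := (Finset.mem_range.mp hl).trans_le hn
          rw [Matrix.conjTranspose_mul, Matrix.conjTranspose_conjTranspose,
            (hc l hl').isHermitian.eq, mass_mul_momentVec_succ hc i hl']
        rw [Finset.sum_congr rfl this, Finset.sum_range_sub]
        obtain ⟨n, rfl⟩ : ∃ k, n = k + 1 := ⟨n - 1, by omega⟩
        simp [flux, momentVec_eq_zero_of_lt i n (by omega),
          momentVec_eq_zero_of_lt i (n + 1) (by omega)])
  refine ⟨h.1, ?_⟩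
  rw [he, h.2]
  refine Finset.sum_congr rfl fun l hl => ?_
  have hcl := hc l ((Finset.mem_range.mp hl).trans_le hn)
  rw [Matrix.nonsing_inv_mul _ hcl.det_isUnit, mul_one, hcl.isHermitian.eq]

/-- The Hankel matrix `H_2` of the moments `(V_j)_0`. -/
theorem hankel_two_momentVec (hm : 1 ≤ m) (hc : ∀ k < m, (c k).PosDef)
    (hd : ∀ k < m, (d k).PosDef) {n : ℕ} (hn : n ≤ m) :
    (blockMat n fun i j => momentVec m c d (i + j + 1) 0).PosDef ∧
      (blockCol n fun i => (momentVec m c d i 0)ᴴ)ᴴ *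
          (blockMat n fun i j => momentVec m c d (i + j + 1) 0)⁻¹ *
          (blockCol n fun i => (momentVec m c d i 0)ᴴ) =
        ∑ l ∈ Finset.range n, d l := by
  have h := gram_posDef_and_inv_form (n := n) (T := fun i j => momentVec m c d (i + j + 1) 0)
    (X := fun l j => momentVec m c d j l - momentVec m c d j (l + 1)) (p := fun l => (d l)⁻¹)
    (x := fun _ => 1) (e := fun i => (momentVec m c d i 0)ᴴ)
    (fun i _ j hj => by
      simp [momentVec_eq_zero_of_lt j i hj, momentVec_eq_zero_of_lt j (i + 1) (by omega)])
    (fun i hi => by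
      simpa [momentVec_eq_zero_of_lt i (i + 1) (by omega)] using
        isUnit_det_momentVec_self hc hd i (by omega))
    (fun i hi => (hd i (by omega)).inv)
    (fun i hi j _ => by
      rw [← stiffForm_momentVec hm hc hd, stiffForm]
      exact (sum_range_momentVec_eq hi hn fun l hl => by
        simp [momentVec_eq_zero_of_lt i l hl,
          momentVec_eq_zero_of_lt i (l + 1) (by omega)]).symm)
    (fun i hi => by
      simp only [mul_one]
      rw [← Matrix.conjTranspose_sum, Finset.sum_range_sub',
        momentVec_eq_zero_of_lt i n hi, sub_zero])
  refine ⟨h.1, h.2.trans (Finset.sum_congr rfl fun l hl => ?_)⟩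
  have hdl := hd l ((Finset.mem_range.mp hl).trans_le hn)
  rw [Matrix.nonsing_inv_nonsing_inv _ hdl.det_isUnit]
  simp

end MomentVectors

section ContinuedFraction

variable {q : ℕ}

/-- The inverse `w_k(z)⁻¹` of the `k`-th tail of the continued fraction, extended by `0` for
`k ≥ m`. -/
def cfTailInv (m : ℕ) (c d : ℕ → Mat q) (z : ℂ) (k : ℕ) : Mat q :=
  if k < m then (wEven q m c d (m - 1 - k) z)⁻¹ else 0

/-- The solution `u` of `(z C + K) u = (I; 0; ...; 0)`. -/
def cfVec (m : ℕ) (c d : ℕ → Mat q) (z : ℂ) : ℕ → Mat q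
  | 0 => cfTailInv m c d z 0
  | k + 1 => cfTailInv m c d z (k + 1) * ((d k + cfTailInv m c d z (k + 1))⁻¹ * cfVec m c d z k)

variable {m : ℕ} {c d : ℕ → Mat q}

theorem wEven_eq_cfTailInv (z : ℂ) {k : ℕ} (hk : k < m) :
    wEven q m c d (m - 1 - k) z = z • c k + (d k + cfTailInv m c d z (k + 1))⁻¹ := by
  by_cases h : k + 1 < m
  · obtain ⟨j, hj⟩ : ∃ j, m = k + 2 + j := ⟨m - (k + 2), by omega⟩
    subst hj
    rw [cfTailInv, if_pos h, show k + 2 + j - 1 - k = j + 1 by omega,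
      show k + 2 + j - 1 - (k + 1) = j by omega, wEven, show k + 2 + j - 2 - j = k by omega]
  · obtain rfl : m = k + 1 := by omega
    simp [cfTailInv, wEven]

theorem cfTailInv_posSemidef (hc : ∀ k < m, (c k).PosDef) (hd : ∀ k < m, (d k).PosDef)
    {z : ℂ} (hz : 0 < z) (k : ℕ) : (cfTailInv m c d z k).PosSemidef := by
  by_cases hk : k < m
  · induction hn : m - k generalizing k with
    | zero => omega
    | succ n ih =>
      have hv : (cfTailInv m c d z (k + 1)).PosSemidef := by
        by_cases h : k + 1 < m
        · exact ih (k + 1) h (by omega)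
        · simpa [cfTailInv, h] using Matrix.PosSemidef.zero
      rw [cfTailInv, if_pos hk, wEven_eq_cfTailInv z hk]
      exact (((hc k hk).smul hz).add ((hd k hk).add_posSemidef hv).inv).inv.posSemidef
  · simpa [cfTailInv, hk] using Matrix.PosSemidef.zero

theorem add_cfTailInv_posDef (hc : ∀ k < m, (c k).PosDef) (hd : ∀ k < m, (d k).PosDef)
    {z : ℂ} (hz : 0 < z) {k : ℕ} (hk : k < m) : (d k + cfTailInv m c d z (k + 1)).PosDef :=
  (hd k hk).add_posSemidef (cfTailInv_posSemidef hc hd hz _)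

theorem wEven_posDef (hc : ∀ k < m, (c k).PosDef) (hd : ∀ k < m, (d k).PosDef)
    {z : ℂ} (hz : 0 < z) {k : ℕ} (hk : k < m) : (wEven q m c d (m - 1 - k) z).PosDef := by
  rw [wEven_eq_cfTailInv z hk]
  exact ((hc k hk).smul hz).add (add_cfTailInv_posDef hc hd hz hk).inv

theorem flux_cfVec (hc : ∀ k < m, (c k).PosDef) (hd : ∀ k < m, (d k).PosDef)
    {z : ℂ} (hz : 0 < z) {k : ℕ} (hk : k < m) :
    flux d (cfVec m c d z) (k + 1) = (d k + cfTailInv m c d z (k + 1))⁻¹ * cfVec m c d z k := by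
  have hu := (add_cfTailInv_posDef hc hd hz hk).det_isUnit
  have h : cfVec m c d z k = (d k + cfTailInv m c d z (k + 1)) *
      ((d k + cfTailInv m c d z (k + 1))⁻¹ * cfVec m c d z k) :=
    (Matrix.mul_nonsing_inv_cancel_left _ _ hu).symm
  rw [flux, cfVec]
  nth_rewrite 1 [h]
  rw [← sub_mul, add_sub_cancel_right, Matrix.nonsing_inv_mul_cancel_left _ _ (hd k hk).det_isUnit]

/-- The `k`-th block row of `(z C + K) u = (I; 0; ...; 0)`. -/
theorem smul_mass_mul_cfVec_add (hc : ∀ k < m, (c k).PosDef) (hd : ∀ k < m, (d k).PosDef)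
    {z : ℂ} (hz : 0 < z) {k : ℕ} (hk : k < m) :
    z • (c k * cfVec m c d z k) +
        (flux d (cfVec m c d z) (k + 1) - flux d (cfVec m c d z) k) =
      if k = 0 then 1 else 0 := by
  have hw := (wEven_posDef hc hd hz hk).det_isUnit
  have h : z • (c k * cfVec m c d z k) + flux d (cfVec m c d z) (k + 1) =
      wEven q m c d (m - 1 - k) z * cfVec m c d z k := by
    rw [flux_cfVec hc hd hz hk, wEven_eq_cfTailInv z hk, add_mul, Matrix.smul_mul]
  rw [← add_sub_assoc, h]
  cases k with
  | zero =>
    rw [cfVec, cfTailInv, if_pos hk, Matrix.mul_nonsing_inv _ hw]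
    simp [flux]
  | succ k =>
    rw [flux_cfVec hc hd hz (by omega), cfVec]
    nth_rewrite 1 [cfTailInv]
    rw [if_pos hk, Matrix.mul_nonsing_inv_cancel_left _ _ hw]
    simp

theorem cfVec_eq_zero (hm : 1 ≤ m) (z : ℂ) : cfVec m c d z m = 0 := by
  obtain ⟨n, rfl⟩ : ∃ n, m = n + 1 := ⟨m - 1, by omega⟩
  simp [cfVec, cfTailInv]

theorem smul_massForm_cfVec_add (hm : 1 ≤ m) (hc : ∀ k < m, (c k).PosDef)
    (hd : ∀ k < m, (d k).PosDef) {z : ℂ} (hz : 0 < z) (j : ℕ) :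
    z • massForm m c (momentVec m c d j) (cfVec m c d z) +
        massForm m c (momentVec m c d (j + 1)) (cfVec m c d z) =
      (momentVec m c d j 0)ᴴ := by
  rw [← massForm_conjTranspose hc _ (momentVec m c d (j + 1)),
    massForm_momentVec_succ hc (cfVec_eq_zero hm z), stiffForm_conjTranspose hd,
    ← sum_conjTranspose_mul_flux_sub _ _ (momentVec_eq_zero_of_le hm j le_rfl), massForm,
    Finset.smul_sum, ← Finset.sum_add_distrib]
  have h : ∀ l ∈ Finset.range m,
      z • ((momentVec m c d j l)ᴴ * (c l * cfVec m c d z l)) +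
        (momentVec m c d j l)ᴴ *
          (flux d (cfVec m c d z) (l + 1) - flux d (cfVec m c d z) l) =
      if l = 0 then (momentVec m c d j l)ᴴ else 0 := by
    intro l hl
    rw [← Matrix.mul_smul, ← mul_add,
      smul_mass_mul_cfVec_add hc hd hz (Finset.mem_range.mp hl)]
    split_ifs <;> simp
  rw [Finset.sum_congr rfl h]
  simp [show 0 < m by omega]

/-- The expansion of `w_0(z)⁻¹` in powers of `z⁻¹`, with explicit remainder. -/
theorem pow_smul_cfTailInv_zero (hm : 1 ≤ m) (hc : ∀ k < m, (c k).PosDef)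
    (hd : ∀ k < m, (d k).PosDef) {z : ℂ} (hz : 0 < z) (n : ℕ) :
    z ^ n • cfTailInv m c d z 0 =
      ∑ j ∈ Finset.range n, ((-1 : ℂ) ^ j * z ^ (n - 1 - j)) • (momentVec m c d j 0)ᴴ +
        (-1 : ℂ) ^ n • massForm m c (momentVec m c d n) (cfVec m c d z) := by
  induction n with
  | zero => simp [massForm_momentVec_zero_left hm hc, cfVec]
  | succ n ih =>
    have h := smul_massForm_cfVec_add hm hc hd hz n
    have hs : z • ∑ j ∈ Finset.range n,
        ((-1 : ℂ) ^ j * z ^ (n - 1 - j)) • (momentVec m c d j 0)ᴴ =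
        ∑ j ∈ Finset.range n, ((-1 : ℂ) ^ j * z ^ (n - j)) • (momentVec m c d j 0)ᴴ := by
      rw [Finset.smul_sum]
      refine Finset.sum_congr rfl fun j hj => ?_
      have := Finset.mem_range.mp hj
      rw [smul_smul, show n - j = n - 1 - j + 1 by omega, pow_succ]
      congr 1
      ring
    rw [pow_succ', mul_smul, ih, smul_add, hs, Finset.sum_range_succ, Nat.add_sub_cancel,
      Nat.sub_self, ← h, smul_comm z]
    simp only [pow_succ, pow_zero, mul_one, smul_add, mul_neg, neg_smul]
    abel

end ContinuedFraction

section Asymptotics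

variable {q : ℕ}

theorem tendsto_matrix_inv {α : Type*} {l : Filter α} {F : α → Mat q} {M : Mat q}
    (hF : Tendsto F l (𝓝 M)) (hM : IsUnit M.det) :
    Tendsto (fun x => (F x)⁻¹) l (𝓝 M⁻¹) :=
  (continuousAt_matrix_inv M (NormedRing.inverse_continuousAt hM.unit)).tendsto.comp hF

theorem tendsto_ofReal_inv : Tendsto (fun x : ℝ => ((x : ℂ))⁻¹) atTop (𝓝 0) := by
  have h := (Complex.continuous_ofReal.tendsto 0).comp (tendsto_inv_atTop_zero (𝕜 := ℝ))
  simpa [Function.comp_def] using h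

theorem tendsto_sum_inv_pow_smul (n : ℕ) (D : ℕ → Mat q) :
    Tendsto (fun x : ℝ => ∑ j ∈ Finset.range (n + 1), ((x : ℂ))⁻¹ ^ j • D j) atTop
      (𝓝 (D 0)) := by
  have hcont : Continuous fun t : ℂ => ∑ j ∈ Finset.range (n + 1), t ^ j • D j := by fun_prop
  have h := (hcont.tendsto 0).comp tendsto_ofReal_inv
  simpa [Finset.sum_range_succ', Function.comp_def] using h

theorem inv_pow_smul_sum (n : ℕ) (D : ℕ → Mat q) {z : ℂ} (hz : z ≠ 0) :
    z⁻¹ ^ n • ∑ j ∈ Finset.range (n + 1), z ^ (n - j) • D j =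
      ∑ j ∈ Finset.range (n + 1), z⁻¹ ^ j • D j := by
  rw [Finset.smul_sum]
  refine Finset.sum_congr rfl fun j hj => ?_
  have hj' : j ≤ n := Nat.lt_succ_iff.mp (Finset.mem_range.mp hj)
  obtain ⟨k, rfl⟩ := Nat.exists_eq_add_of_le hj'
  rw [smul_smul, Nat.add_sub_cancel_left, pow_add, mul_assoc, ← mul_pow, inv_mul_cancel₀ hz,
    one_pow, mul_one]

/-- A matrix polynomial tending to `0` at infinity vanishes. -/
theorem eq_zero_of_tendsto_sum_pow_smul (n : ℕ) (D : ℕ → Mat q)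
    (h : Tendsto (fun x : ℝ => ∑ j ∈ Finset.range n, (x : ℂ) ^ (n - 1 - j) • D j) atTop (𝓝 0)) :
    ∀ j < n, D j = 0 := by
  induction n generalizing D with
  | zero => intro j hj; omega
  | succ n ih =>
    have h0 : D 0 = 0 := by
      refine tendsto_nhds_unique (tendsto_sum_inv_pow_smul n D) ?_
      have h1 := (tendsto_ofReal_inv.pow n).smul h
      rw [smul_zero] at h1
      refine h1.congr' ?_
      filter_upwards [eventually_gt_atTop (0 : ℝ)] with x hx
      exact inv_pow_smul_sum n D (by exact_mod_cast hx.ne')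
    have hs := ih (fun j => D (j + 1)) (by
      refine h.congr fun x => ?_
      rw [Finset.sum_range_succ', h0, smul_zero, add_zero]
      refine Finset.sum_congr rfl fun j _ => ?_
      rw [show n + 1 - 1 - (j + 1) = n - 1 - j by omega])
    intro j hj
    cases j with
    | zero => exact h0
    | succ j => exact hs j (by omega)

variable {m : ℕ} {c d : ℕ → Mat q}

theorem tendsto_cfTailInv (hc : ∀ k < m, (c k).PosDef) (hd : ∀ k < m, (d k).PosDef) (k : ℕ) :
    Tendsto (fun x : ℝ => cfTailInv m c d x k) atTop (𝓝 0) := by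
  by_cases hk : k < m
  · induction hn : m - k generalizing k with
    | zero => omega
    | succ n ih =>
      have hv : Tendsto (fun x : ℝ => cfTailInv m c d x (k + 1)) atTop (𝓝 0) := by
        by_cases h : k + 1 < m
        · exact ih (k + 1) h (by omega)
        · simp [cfTailInv, h]
      have h1 : Tendsto (fun x : ℝ => (d k + cfTailInv m c d x (k + 1))⁻¹) atTop
          (𝓝 (d k)⁻¹) := by
        have := tendsto_matrix_inv (hv.const_add (d k)) (by simpa using (hd k hk).det_isUnit)
        simpa using this
      have h2 : Tendsto (fun x : ℝ =>
          (c k + (x : ℂ)⁻¹ • (d k + cfTailInv m c d x (k + 1))⁻¹)⁻¹) atTop (𝓝 (c k)⁻¹) := by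
        have h3 := (tendsto_ofReal_inv.smul h1).const_add (c k)
        rw [zero_smul, add_zero] at h3
        exact tendsto_matrix_inv h3 (hc k hk).det_isUnit
      have h4 := tendsto_ofReal_inv.smul h2
      rw [zero_smul] at h4
      refine h4.congr' ?_
      filter_upwards [eventually_gt_atTop (0 : ℝ)] with x hx
      have hx' : (x : ℂ) ≠ 0 := by exact_mod_cast hx.ne'
      have h5 : wEven q m c d (m - 1 - k) x =
          (x : ℂ) • (c k + (x : ℂ)⁻¹ • (d k + cfTailInv m c d x (k + 1))⁻¹) := by
        rw [wEven_eq_cfTailInv _ hk, smul_add, smul_inv_smul₀ hx']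
      have h6 := (wEven_posDef hc hd (Complex.zero_lt_real.mpr hx) hk).det_isUnit
      rw [show cfTailInv m c d x k = (wEven q m c d (m - 1 - k) x)⁻¹ from if_pos hk]
      refine (Matrix.inv_eq_right_inv ?_).symm
      have h7 : IsUnit (c k + (x : ℂ)⁻¹ • (d k + cfTailInv m c d x (k + 1))⁻¹).det := by
        rw [h5, Matrix.det_smul] at h6
        exact isUnit_of_mul_isUnit_right h6
      rw [h5, Matrix.smul_mul, Matrix.mul_smul, Matrix.mul_nonsing_inv _ h7, smul_inv_smul₀ hx']
  · simp [cfTailInv, hk]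

theorem tendsto_cfVec (hc : ∀ k < m, (c k).PosDef) (hd : ∀ k < m, (d k).PosDef)
    (k : ℕ) (hk : k < m) : Tendsto (fun x : ℝ => cfVec m c d x k) atTop (𝓝 0) := by
  induction k with
  | zero => exact tendsto_cfTailInv hc hd 0
  | succ k ih =>
    have hv := tendsto_cfTailInv hc hd (k + 1)
    have h1 := tendsto_matrix_inv (hv.const_add (d k))
      (by simpa using (hd k (by omega)).det_isUnit)
    simpa [cfVec] using hv.mul (h1.mul (ih (by omega)))

theorem tendsto_massForm_cfVec (hc : ∀ k < m, (c k).PosDef) (hd : ∀ k < m, (d k).PosDef)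
    (X : ℕ → Mat q) : Tendsto (fun x : ℝ => massForm m c X (cfVec m c d x)) atTop (𝓝 0) := by
  have h : Tendsto (fun x : ℝ => massForm m c X (cfVec m c d x)) atTop
      (𝓝 (∑ l ∈ Finset.range m, (X l)ᴴ * (c l * 0))) :=
    tendsto_finsetSum _ fun l hl =>
      ((tendsto_cfVec hc hd l (Finset.mem_range.mp hl)).const_mul _).const_mul _
  simpa using h

/-- The Markov parameters of a Hurwitz-type polynomial are the moments `(V_j)_0`. -/
theorem markovEven_eq_momentVec (hm : 1 ≤ m) {A s : ℕ → Mat q} (hA0 : (A 0).det ≠ 0)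
    (hc : ∀ k < m, (c k).PosDef) (hd : ∀ k < m, (d k).PosDef)
    (hcf : ∀ z : ℂ, (hEven q m A z).det ≠ 0 →
      (∀ j < m, IsUnit (wEven q m c d j z).det) →
      (∀ j, j + 1 < m → IsUnit (d (m - 2 - j) + (wEven q m c d j z)⁻¹).det) →
      gEven q m A z * (hEven q m A z)⁻¹ = (wEven q m c d (m - 1) z)⁻¹)
    (hM : MarkovEven q m A s) {j : ℕ} (hj : j < 2 * m) :
    s j = (momentVec m c d j 0)ᴴ := by
  obtain ⟨B, hB⟩ := hM
  have hh : Tendsto (fun x : ℝ => (x : ℂ)⁻¹ ^ m • hEven q m A x) atTop (𝓝 (A 0)) := by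
    refine (tendsto_sum_inv_pow_smul m fun j => A (2 * j)).congr' ?_
    filter_upwards [eventually_gt_atTop (0 : ℝ)] with x hx
    exact (inv_pow_smul_sum m (fun j => A (2 * j)) (by exact_mod_cast hx.ne')).symm
  have hdet : ∀ᶠ x : ℝ in atTop, (hEven q m A x).det ≠ 0 := by
    have h1 := ((continuous_id.matrix_det).tendsto (A 0)).comp hh
    filter_upwards [h1.eventually_ne hA0] with x hx h0
    exact hx (by simp [h0])
  have hR : Tendsto (fun x : ℝ => (x : ℂ)⁻¹ ^ m • ∑ k ∈ Finset.range m, (x : ℂ) ^ k • B k)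
      atTop (𝓝 0) := by
    refine (tendsto_sum_inv_pow_smul m fun j => if j = 0 then 0 else B (m - j)).congr' ?_
    filter_upwards [eventually_gt_atTop (0 : ℝ)] with x hx
    rw [← inv_pow_smul_sum m _ (by exact_mod_cast hx.ne'), ← Finset.sum_range_reflect,
      Finset.sum_range_succ]
    congr 1
    simp only [Nat.add_sub_cancel, Nat.sub_self, if_true, smul_zero, add_zero]
    refine Finset.sum_congr rfl fun k hk => ?_
    have := Finset.mem_range.mp hk
    rw [if_neg (by omega), Nat.sub_sub_self this.le]
  have hRh : Tendsto (fun x : ℝ =>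
      (∑ k ∈ Finset.range m, (x : ℂ) ^ k • B k) * (hEven q m A x)⁻¹) atTop (𝓝 0) := by
    have h1 := hR.mul (tendsto_matrix_inv hh (isUnit_iff_ne_zero.mpr hA0))
    rw [zero_mul] at h1
    refine h1.congr' ?_
    filter_upwards [eventually_gt_atTop (0 : ℝ), hdet] with x hx hx'
    have hp : (x : ℂ)⁻¹ ^ m ≠ 0 := pow_ne_zero _ (inv_ne_zero (by exact_mod_cast hx.ne'))
    have h2 : ((x : ℂ)⁻¹ ^ m • hEven q m A x)⁻¹ =
        ((x : ℂ)⁻¹ ^ m)⁻¹ • (hEven q m A x)⁻¹ := by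
      refine Matrix.inv_eq_right_inv ?_
      rw [Matrix.smul_mul, Matrix.mul_smul,
        Matrix.mul_nonsing_inv _ (isUnit_iff_ne_zero.mpr hx'), smul_inv_smul₀ hp]
    rw [h2, Matrix.smul_mul, Matrix.mul_smul, smul_inv_smul₀ hp]
  have hdiff : Tendsto (fun x : ℝ => ∑ j ∈ Finset.range (2 * m),
      (x : ℂ) ^ (2 * m - 1 - j) • ((-1 : ℂ) ^ j • (s j - (momentVec m c d j 0)ᴴ)))
      atTop (𝓝 0) := by
    have h1 := ((tendsto_massForm_cfVec hc hd (momentVec m c d (2 * m))).const_smul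
      ((-1 : ℂ) ^ (2 * m))).sub hRh
    rw [smul_zero, sub_zero] at h1
    refine h1.congr' ?_
    filter_upwards [eventually_gt_atTop (0 : ℝ), hdet] with x hx hx'
    have hz : (0 : ℂ) < x := Complex.zero_lt_real.mpr hx
    have hF : gEven q m A x * (hEven q m A x)⁻¹ = cfTailInv m c d x 0 := by
      rw [cfTailInv, if_pos (by omega), Nat.sub_zero]
      refine hcf x hx' (fun j hj => ?_) fun j hj => ?_
      · have := (wEven_posDef hc hd hz (k := m - 1 - j) (by omega)).det_isUnit
        rwa [show m - 1 - (m - 1 - j) = j by omega] at this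
      · have := (add_cfTailInv_posDef hc hd hz (k := m - 2 - j) (by omega)).det_isUnit
        rwa [cfTailInv, if_pos (by omega), show m - 1 - (m - 2 - j + 1) = j by omega] at this
    have h2 := pow_smul_cfTailInv_zero hm hc hd hz (2 * m)
    rw [← hB x, sub_mul, Matrix.smul_mul, hF,
      Matrix.mul_nonsing_inv_cancel_right _ _ (isUnit_iff_ne_zero.mpr hx'), h2]
    simp only [smul_smul, smul_sub, Finset.sum_sub_distrib, mul_comm ((x : ℂ) ^ _)]
    abel
  have h := eq_zero_of_tendsto_sum_pow_smul _ _ hdiff j hj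
  rw [smul_eq_zero] at h
  exact sub_eq_zero.mp (h.resolve_left (pow_ne_zero _ (by norm_num)))

end Asymptotics

theorem stmt_5 (q m : ℕ) (hq : 1 ≤ q) (hm : 1 ≤ m) (A s c d : ℕ → Mat q)
    (hA0 : (A 0).det ≠ 0)
    (hc : ∀ k < m, (c k).PosDef) (hd : ∀ k < m, (d k).PosDef)
    (hcf : ∀ z : ℂ, (hEven q m A z).det ≠ 0 →
      (∀ j < m, IsUnit (wEven q m c d j z).det) →
      (∀ j, j + 1 < m → IsUnit (d (m - 2 - j) + (wEven q m c d j z)⁻¹).det) →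
      gEven q m A z * (hEven q m A z)⁻¹ = (wEven q m c d (m - 1) z)⁻¹)
    (hherm : ∀ j < 2 * m, (s j).IsHermitian)
    (hM : MarkovEven q m A s) :
    (∀ k < m, (H1b q s (k + 1)).PosDef ∧ (H2b q s (k + 1)).PosDef) ∧
    c 0 = (s 0)⁻¹ ∧ d 0 = s 0 * (s 1)⁻¹ * s 0 ∧
    ∀ k, 1 ≤ k → k < m →
      (c k = (eCol q (k + 1))ᴴ * (H1b q s (k + 1))⁻¹ * eCol q (k + 1)
              - (eCol q k)ᴴ * (H1b q s k)⁻¹ * eCol q k ∧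
       d k = (yCol q s (k + 1))ᴴ * (H2b q s (k + 1))⁻¹ * yCol q s (k + 1)
              - (yCol q s k)ᴴ * (H2b q s k)⁻¹ * yCol q s k) := by
  have hs : ∀ j < 2 * m, s j = (momentVec m c d j 0)ᴴ := fun j hj =>
    markovEven_eq_momentVec hm hA0 hc hd hcf hM hj
  have hs' : ∀ j < 2 * m, s j = momentVec m c d j 0 := fun j hj => by
    rw [← (hherm j hj).eq, hs j hj, Matrix.conjTranspose_conjTranspose]
  have h1 : ∀ n ≤ m, H1b q s n = blockMat n fun i j => momentVec m c d (i + j) 0 :=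
    fun n hn => blockMat_congr (X := fun i j => s (i + j)) fun i hi j hj => hs' _ (by omega)
  have h2 : ∀ n ≤ m, H2b q s n = blockMat n fun i j => momentVec m c d (i + j + 1) 0 :=
    fun n hn => blockMat_congr (X := fun i j => s (i + j + 1)) fun i hi j hj => hs' _ (by omega)
  have hy : ∀ n ≤ m, yCol q s n = blockCol n fun i => (momentVec m c d i 0)ᴴ :=
    fun n hn => blockCol_congr fun i hi => hs i (by omega)
  have hpd1 : ∀ n ≤ m, (H1b q s n).PosDef := fun n hn => by
    rw [h1 n hn]; exact (hankel_one_momentVec hm hc hd hn).1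
  have hpd2 : ∀ n ≤ m, (H2b q s n).PosDef := fun n hn => by
    rw [h2 n hn]; exact (hankel_two_momentVec hm hc hd hn).1
  have hf1 : ∀ n ≤ m, (eCol q n)ᴴ * (H1b q s n)⁻¹ * eCol q n = ∑ l ∈ Finset.range n, c l :=
    fun n hn => by rw [h1 n hn]; exact (hankel_one_momentVec hm hc hd hn).2
  have hf2 : ∀ n ≤ m,
      (yCol q s n)ᴴ * (H2b q s n)⁻¹ * yCol q s n = ∑ l ∈ Finset.range n, d l :=
    fun n hn => by rw [h2 n hn, hy n hn]; exact (hankel_two_momentVec hm hc hd hn).2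
  have hs0 : s 0 = (c 0)⁻¹ := by rw [hs' 0 (by omega)]; simp [momentVec]
  have hs1 : s 1 = (c 0)⁻¹ * ((d 0)⁻¹ * (c 0)⁻¹) := by
    rw [hs' 1 (by omega)]; simp [momentVec, flux, show 0 < m by omega]
  have hc0 := (hc 0 hm).det_isUnit
  have hd0 := (hd 0 hm).det_isUnit
  refine ⟨fun k hk => ⟨hpd1 _ hk, hpd2 _ hk⟩, ?_, ?_, fun k _ hk => ⟨?_, ?_⟩⟩
  · rw [hs0, Matrix.nonsing_inv_nonsing_inv _ hc0]
  · rw [hs0, hs1, Matrix.mul_inv_rev, Matrix.mul_inv_rev, Matrix.nonsing_inv_nonsing_inv _ hc0,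
      Matrix.nonsing_inv_nonsing_inv _ hd0]
    simp only [Matrix.mul_assoc]
    rw [Matrix.nonsing_inv_mul_cancel_left _ _ hc0, Matrix.mul_nonsing_inv _ hc0, Matrix.mul_one]
  · rw [hf1 _ hk, hf1 _ hk.le, Finset.sum_range_succ, add_sub_cancel_left]
  · rw [hf2 _ hk, hf2 _ hk.le, Finset.sum_range_succ, add_sub_cancel_left]

end
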